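/- The quotient ring ℤ[t₁,…,t₅]/(tᵢ² + tᵢ + 1 (i = 1,…,5), ρ_J (J ∈ 𝒦)) is torsion-free as an abelian group, where 𝒦 = {[01|23|45], [01|24|35], [02|13|45], [02|14|35]} and ρ_{[j₀k₀|j₁k₁|j₂k₂]} = (1 + t_{j₁} + t_{j₁}t_{k₁})(1 + t_{j₂} + t_{j₂}t_{k₂}) (with t₀ interpreted as absent, indices among 1,…,5). -/

import Mathlib

open MvPolynomial

noncomputable section

/-- `t₁,…,t₅` are `X 0,…,X 4`.  The four polynomials `ρ_J` for
`𝒦 = {[01|23|45], [01|24|35], [02|13|45], [02|14|35]}`. -/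
def rho : Fin 4 → MvPolynomial (Fin 5) ℤ :=
  ![(1 + X 1 + X 1 * X 2) * (1 + X 3 + X 3 * X 4),
    (1 + X 1 + X 1 * X 3) * (1 + X 2 + X 2 * X 4),
    (1 + X 0 + X 0 * X 2) * (1 + X 3 + X 3 * X 4),
    (1 + X 0 + X 0 * X 3) * (1 + X 2 + X 2 * X 4)]

/-- The ideal `(tᵢ² + tᵢ + 1 (i=1,…,5), ρ_J (J ∈ 𝒦))` of `ℤ[t₁,…,t₅]`. -/
def dsIdeal : Ideal (MvPolynomial (Fin 5) ℤ) :=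
  Ideal.span ((Set.range fun i : Fin 5 => X i ^ 2 + X i + 1) ∪ Set.range rho)

set_option linter.unusedVariables false

/-- The general integer combination of the 14 standard monomials. -/
def stdForm {R : Type*} [CommRing R] (a b c d e : R) (z : Fin 14 → ℤ) : R :=
  (z 0 : R)*(1) + (z 1 : R)*(a) + (z 2 : R)*(b) + (z 3 : R)*(c) + (z 4 : R)*(d) + (z 5 : R)*(e) + (z 6 : R)*(a*b) + (z 7 : R)*(a*e) + (z 8 : R)*(b*e) + (z 9 : R)*(c*d) + (z 10 : R)*(c*e) + (z 11 : R)*(d*e) + (z 12 : R)*(a*b*e) + (z 13 : R)*(c*d*e)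

theorem stdForm_mul_a {R : Type*} [CommRing R] {a b c d e : R}
    (h1 : a^2+a+1 = 0) (h2 : b^2+b+1 = 0) (h3 : c^2+c+1 = 0) (h4 : d^2+d+1 = 0)
    (h5 : e^2+e+1 = 0) (h13 : (a-d)*(c-e) = 0) (h14 : (a-c)*(d-e) = 0)
    (h23 : (b-d)*(c-e) = 0) (h24 : (b-c)*(d-e) = 0)
    (z : Fin 14 → ℤ) : ∃ y : Fin 14 → ℤ, stdForm a b c d e z * a = stdForm a b c d e y := by
  refine ⟨![(-1)*z 1 + (-1)*z 13,
    (1)*z 0 + (-1)*z 1 + (-1)*z 9 + (-1)*z 10 + (-1)*z 11 + (1)*z 13,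
    (-1)*z 6,
    (1)*z 11 + (-1)*z 13,
    (1)*z 10 + (-1)*z 13,
    (-1)*z 7 + (1)*z 9 + (-1)*z 13,
    (1)*z 2 + (-1)*z 6,
    (1)*z 3 + (1)*z 4 + (1)*z 5 + (-1)*z 7 + (-1)*z 9 + (-1)*z 10 + (-1)*z 11,
    (-1)*z 12,
    (1)*z 3 + (1)*z 4 + (-1)*z 9 + (-1)*z 13,
    (-1)*z 4 + (1)*z 9 + (1)*z 11 + (-1)*z 13,
    (-1)*z 3 + (1)*z 9 + (1)*z 10 + (-1)*z 13,
    (1)*z 8 + (-1)*z 12,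
    (1)*z 9 + (1)*z 10 + (1)*z 11 + (-2)*z 13], ?_⟩
  simp [stdForm]
  linear_combination ((z 1 : R)*((1)*1) + (z 6 : R)*((1)*b) + (z 7 : R)*((1)*e) + (z 12 : R)*((1)*b*e))*h1 +
    ((z 3 : R)*((1)*1) + (z 9 : R)*((1)*d) + (z 10 : R)*((1)*e) + (z 13 : R)*((1)*d*e))*h13 +
    ((z 4 : R)*((1)*1) + (z 9 : R)*((1)*e) + (z 11 : R)*((1)*e) + (z 13 : R)*((1)*e^2))*h14 +
    ((z 9 : R)*((1)*a + (-1)*c) + (z 10 : R)*((1)*a + (-1)*d) + (z 11 : R)*((1)*a + (-1)*c) + (z 13 : R)*((1)*a*e + (1)*c*d + (-1)*c*e + (-1)*a + (1)*c + (1)*d + (1)*1))*h5 +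
    ((z 9 : R)*((1)*c + (-1)*e) + (z 13 : R)*((1)*c*e + (-1)*e^2))*h4

theorem stdForm_mul_b {R : Type*} [CommRing R] {a b c d e : R}
    (h1 : a^2+a+1 = 0) (h2 : b^2+b+1 = 0) (h3 : c^2+c+1 = 0) (h4 : d^2+d+1 = 0)
    (h5 : e^2+e+1 = 0) (h13 : (a-d)*(c-e) = 0) (h14 : (a-c)*(d-e) = 0)
    (h23 : (b-d)*(c-e) = 0) (h24 : (b-c)*(d-e) = 0)
    (z : Fin 14 → ℤ) : ∃ y : Fin 14 → ℤ, stdForm a b c d e z * b = stdForm a b c d e y := by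
  refine ⟨![(-1)*z 2 + (-1)*z 13,
    (-1)*z 6,
    (1)*z 0 + (-1)*z 2 + (-1)*z 9 + (-1)*z 10 + (-1)*z 11 + (1)*z 13,
    (1)*z 11 + (-1)*z 13,
    (1)*z 10 + (-1)*z 13,
    (-1)*z 8 + (1)*z 9 + (-1)*z 13,
    (1)*z 1 + (-1)*z 6,
    (-1)*z 12,
    (1)*z 3 + (1)*z 4 + (1)*z 5 + (-1)*z 8 + (-1)*z 9 + (-1)*z 10 + (-1)*z 11,
    (1)*z 3 + (1)*z 4 + (-1)*z 9 + (-1)*z 13,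
    (-1)*z 4 + (1)*z 9 + (1)*z 11 + (-1)*z 13,
    (-1)*z 3 + (1)*z 9 + (1)*z 10 + (-1)*z 13,
    (1)*z 7 + (-1)*z 12,
    (1)*z 9 + (1)*z 10 + (1)*z 11 + (-2)*z 13], ?_⟩
  simp [stdForm]
  linear_combination ((z 2 : R)*((1)*1) + (z 6 : R)*((1)*a) + (z 8 : R)*((1)*e) + (z 12 : R)*((1)*a*e))*h2 +
    ((z 3 : R)*((1)*1) + (z 9 : R)*((1)*d) + (z 10 : R)*((1)*e) + (z 13 : R)*((1)*d*e))*h23 +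
    ((z 4 : R)*((1)*1) + (z 9 : R)*((1)*e) + (z 11 : R)*((1)*e) + (z 13 : R)*((1)*e^2))*h24 +
    ((z 9 : R)*((1)*b + (-1)*c) + (z 10 : R)*((1)*b + (-1)*d) + (z 11 : R)*((1)*b + (-1)*c) + (z 13 : R)*((1)*b*e + (1)*c*d + (-1)*c*e + (-1)*b + (1)*c + (1)*d + (1)*1))*h5 +
    ((z 9 : R)*((1)*c + (-1)*e) + (z 13 : R)*((1)*c*e + (-1)*e^2))*h4

theorem stdForm_mul_c {R : Type*} [CommRing R] {a b c d e : R}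
    (h1 : a^2+a+1 = 0) (h2 : b^2+b+1 = 0) (h3 : c^2+c+1 = 0) (h4 : d^2+d+1 = 0)
    (h5 : e^2+e+1 = 0) (h13 : (a-d)*(c-e) = 0) (h14 : (a-c)*(d-e) = 0)
    (h23 : (b-d)*(c-e) = 0) (h24 : (b-c)*(d-e) = 0)
    (z : Fin 14 → ℤ) : ∃ y : Fin 14 → ℤ, stdForm a b c d e z * c = stdForm a b c d e y := by
  refine ⟨![(-1)*z 3 + (-1)*z 12,
    (-1)*z 7,
    (-1)*z 8,
    (1)*z 0 + (-1)*z 3 + (-1)*z 6,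
    (1)*z 7 + (1)*z 8 + (-1)*z 9 + (-1)*z 12,
    (1)*z 6 + (-1)*z 10 + (-1)*z 12,
    (-1)*z 12,
    (1)*z 1 + (-1)*z 7,
    (1)*z 2 + (-1)*z 8,
    (1)*z 1 + (1)*z 2 + (1)*z 4 + (-1)*z 6 + (-1)*z 9,
    (1)*z 5 + (-1)*z 10 + (-1)*z 12,
    (-1)*z 1 + (-1)*z 2 + (1)*z 6 + (1)*z 7 + (1)*z 8 + (-1)*z 12 + (-1)*z 13,
    (1)*z 6 + (-1)*z 12,
    (1)*z 7 + (1)*z 8 + (1)*z 11 + (-1)*z 12 + (-1)*z 13], ?_⟩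
  simp [stdForm]
  linear_combination ((z 1 : R)*((1)*1) + (z 6 : R)*((1)*b) + (z 7 : R)*((1)*e) + (z 12 : R)*((1)*b*e))*h13 +
    ((z 2 : R)*((1)*1) + (z 6 : R)*((1)*d) + (z 8 : R)*((1)*e) + (z 12 : R)*((1)*d*e))*h23 +
    ((z 3 : R)*((1)*1) + (z 9 : R)*((1)*d) + (z 10 : R)*((1)*e) + (z 13 : R)*((1)*d*e))*h3 +
    ((z 6 : R)*((1)*c + (-1)*e) + (z 12 : R)*((1)*c*e + (-1)*e^2))*h4 +
    ((z 7 : R)*((1)*a + (-1)*d) + (z 8 : R)*((1)*b + (-1)*d) + (z 12 : R)*((1)*a*b + (1)*d + (1)*1))*h5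

theorem stdForm_mul_d {R : Type*} [CommRing R] {a b c d e : R}
    (h1 : a^2+a+1 = 0) (h2 : b^2+b+1 = 0) (h3 : c^2+c+1 = 0) (h4 : d^2+d+1 = 0)
    (h5 : e^2+e+1 = 0) (h13 : (a-d)*(c-e) = 0) (h14 : (a-c)*(d-e) = 0)
    (h23 : (b-d)*(c-e) = 0) (h24 : (b-c)*(d-e) = 0)
    (z : Fin 14 → ℤ) : ∃ y : Fin 14 → ℤ, stdForm a b c d e z * d = stdForm a b c d e y := by
  refine ⟨![(-1)*z 4 + (-1)*z 12,
    (-1)*z 7,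
    (-1)*z 8,
    (1)*z 7 + (1)*z 8 + (-1)*z 9 + (-1)*z 12,
    (1)*z 0 + (-1)*z 4 + (-1)*z 6,
    (1)*z 6 + (-1)*z 11 + (-1)*z 12,
    (-1)*z 12,
    (1)*z 1 + (-1)*z 7,
    (1)*z 2 + (-1)*z 8,
    (1)*z 1 + (1)*z 2 + (1)*z 3 + (-1)*z 6 + (-1)*z 9,
    (-1)*z 1 + (-1)*z 2 + (1)*z 6 + (1)*z 7 + (1)*z 8 + (-1)*z 12 + (-1)*z 13,
    (1)*z 5 + (-1)*z 11 + (-1)*z 12,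
    (1)*z 6 + (-1)*z 12,
    (1)*z 7 + (1)*z 8 + (1)*z 10 + (-1)*z 12 + (-1)*z 13], ?_⟩
  simp [stdForm]
  linear_combination ((z 1 : R)*((1)*1) + (z 6 : R)*((1)*b) + (z 7 : R)*((1)*e) + (z 12 : R)*((1)*b*e))*h14 +
    ((z 2 : R)*((1)*1) + (z 6 : R)*((1)*e) + (z 8 : R)*((1)*e) + (z 12 : R)*((1)*e^2))*h24 +
    ((z 4 : R)*((1)*1) + (z 6 : R)*((1)*c + (-1)*e) + (z 9 : R)*((1)*c) + (z 11 : R)*((1)*e) + (z 12 : R)*((1)*c*e + (-1)*e^2) + (z 13 : R)*((1)*c*e))*h4 +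
    ((z 6 : R)*((1)*d + (-1)*e) + (z 12 : R)*((1)*d*e + (-1)*e^2))*h23 +
    ((z 6 : R)*((-1)*c + (1)*d) + (z 7 : R)*((1)*a + (-1)*c) + (z 8 : R)*((1)*b + (-1)*c) + (z 12 : R)*((1)*a*b + (-1)*c*e + (1)*d*e + (1)*c + (1)*1))*h5

theorem stdForm_mul_e {R : Type*} [CommRing R] {a b c d e : R}
    (h1 : a^2+a+1 = 0) (h2 : b^2+b+1 = 0) (h3 : c^2+c+1 = 0) (h4 : d^2+d+1 = 0)
    (h5 : e^2+e+1 = 0) (h13 : (a-d)*(c-e) = 0) (h14 : (a-c)*(d-e) = 0)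
    (h23 : (b-d)*(c-e) = 0) (h24 : (b-c)*(d-e) = 0)
    (z : Fin 14 → ℤ) : ∃ y : Fin 14 → ℤ, stdForm a b c d e z * e = stdForm a b c d e y := by
  refine ⟨![(-1)*z 5,
    (-1)*z 7,
    (-1)*z 8,
    (-1)*z 10,
    (-1)*z 11,
    (1)*z 0 + (-1)*z 5,
    (-1)*z 12,
    (1)*z 1 + (-1)*z 7,
    (1)*z 2 + (-1)*z 8,
    (-1)*z 13,
    (1)*z 3 + (-1)*z 10,
    (1)*z 4 + (-1)*z 11,
    (1)*z 6 + (-1)*z 12,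
    (1)*z 9 + (-1)*z 13], ?_⟩
  simp [stdForm]
  linear_combination ((z 5 : R)*((1)*1) + (z 7 : R)*((1)*a) + (z 8 : R)*((1)*b) + (z 10 : R)*((1)*c) + (z 11 : R)*((1)*d) + (z 12 : R)*((1)*a*b) + (z 13 : R)*((1)*c*d))*h5

/-- The Eisenstein integers. -/
abbrev Eis := QuadraticAlgebra ℤ (-1) (-1)

/-- Seven common zeros of the ideal. -/
def pts : Fin 7 → Fin 5 → Eis :=
  ![![⟨0, 1⟩, ⟨0, 1⟩, ⟨0, 1⟩, ⟨0, 1⟩, ⟨0, 1⟩],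
    ![⟨0, 1⟩, ⟨0, 1⟩, ⟨0, 1⟩, ⟨0, 1⟩, ⟨-1, -1⟩],
    ![⟨0, 1⟩, ⟨0, 1⟩, ⟨0, 1⟩, ⟨-1, -1⟩, ⟨0, 1⟩],
    ![⟨0, 1⟩, ⟨0, 1⟩, ⟨-1, -1⟩, ⟨0, 1⟩, ⟨0, 1⟩],
    ![⟨0, 1⟩, ⟨0, 1⟩, ⟨-1, -1⟩, ⟨-1, -1⟩, ⟨-1, -1⟩],
    ![⟨0, 1⟩, ⟨-1, -1⟩, ⟨0, 1⟩, ⟨0, 1⟩, ⟨0, 1⟩],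
    ![⟨0, 1⟩, ⟨-1, -1⟩, ⟨-1, -1⟩, ⟨-1, -1⟩, ⟨-1, -1⟩]]

/-- The class of a variable. -/
def tt (i : Fin 5) : MvPolynomial (Fin 5) ℤ ⧸ dsIdeal := Ideal.Quotient.mk dsIdeal (X i)

theorem tt_sq (i : Fin 5) : tt i ^ 2 + tt i + 1 = 0 := by
  have : (X i ^ 2 + X i + 1 : MvPolynomial (Fin 5) ℤ) ∈ dsIdeal :=
    Ideal.subset_span (Or.inl ⟨i, rfl⟩)
  simpa [tt] using Ideal.Quotient.eq_zero_iff_mem.mpr this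

theorem mk_rho (i : Fin 4) : Ideal.Quotient.mk dsIdeal (rho i) = 0 :=
  Ideal.Quotient.eq_zero_iff_mem.mpr (Ideal.subset_span (Or.inr ⟨i, rfl⟩))

theorem unit_trick {R : Type*} [CommRing R] {a b c d : R} (ha : a^2+a+1 = 0) (hc : c^2+c+1 = 0)
    (h : (1 + a + a*b) * (1 + c + c*d) = 0) : (a - b) * (c - d) = 0 := by
  have e1 : 1 + a + a*b = a * (b - a) := by linear_combination ha
  have e2 : 1 + c + c*d = c * (d - c) := by linear_combination hc
  have a3 : a^3 = 1 := by linear_combination (a-1)*ha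
  have c3 : c^3 = 1 := by linear_combination (c-1)*hc
  rw [e1, e2] at h
  linear_combination a^2*c^2*h - (a-b)*(c-d)*c^3*a3 - (a-b)*(c-d)*c3

theorem exists_stdForm (p : MvPolynomial (Fin 5) ℤ) : ∃ z : Fin 14 → ℤ,
    Ideal.Quotient.mk dsIdeal p = stdForm (tt 0) (tt 1) (tt 2) (tt 3) (tt 4) z := by
  have r0 : (tt 1 - tt 2) * (tt 3 - tt 4) = 0 :=
    unit_trick (tt_sq 1) (tt_sq 3) (by simpa [rho, tt] using mk_rho 0)
  have r1 : (tt 1 - tt 3) * (tt 2 - tt 4) = 0 :=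
    unit_trick (tt_sq 1) (tt_sq 2) (by simpa [rho, tt] using mk_rho 1)
  have r2 : (tt 0 - tt 2) * (tt 3 - tt 4) = 0 :=
    unit_trick (tt_sq 0) (tt_sq 3) (by simpa [rho, tt] using mk_rho 2)
  have r3 : (tt 0 - tt 3) * (tt 2 - tt 4) = 0 :=
    unit_trick (tt_sq 0) (tt_sq 2) (by simpa [rho, tt] using mk_rho 3)
  induction p using MvPolynomial.induction_on with
  | C n => exact ⟨![n,0,0,0,0,0,0,0,0,0,0,0,0,0], by simp [stdForm]⟩
  | add p q hp hq =>
    obtain ⟨y, hy⟩ := hp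
    obtain ⟨z, hz⟩ := hq
    refine ⟨y + z, ?_⟩
    rw [map_add, hy, hz]
    simp only [stdForm, Pi.add_apply]
    push_cast
    ring
  | mul_X p i hp =>
    obtain ⟨y, hy⟩ := hp
    rw [map_mul, hy]
    change ∃ z, _ * tt i = _
    fin_cases i
    · exact stdForm_mul_a (tt_sq 0) (tt_sq 1) (tt_sq 2) (tt_sq 3) (tt_sq 4) r3 r2 r1 r0 y
    · exact stdForm_mul_b (tt_sq 0) (tt_sq 1) (tt_sq 2) (tt_sq 3) (tt_sq 4) r3 r2 r1 r0 y
    · exact stdForm_mul_c (tt_sq 0) (tt_sq 1) (tt_sq 2) (tt_sq 3) (tt_sq 4) r3 r2 r1 r0 y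
    · exact stdForm_mul_d (tt_sq 0) (tt_sq 1) (tt_sq 2) (tt_sq 3) (tt_sq 4) r3 r2 r1 r0 y
    · exact stdForm_mul_e (tt_sq 0) (tt_sq 1) (tt_sq 2) (tt_sq 3) (tt_sq 4) r3 r2 r1 r0 y

theorem aeval_pts (k : Fin 7) (p : MvPolynomial (Fin 5) ℤ) (hp : p ∈ dsIdeal) :
    aeval (pts k) p = 0 := by
  have : dsIdeal ≤ RingHom.ker (aeval (R := ℤ) (pts k)).toRingHom := by
    rw [dsIdeal, Ideal.span_le]
    rintro _ (⟨i, rfl⟩ | ⟨i, rfl⟩)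
    · suffices h : pts k i ^ 2 + pts k i + 1 = 0 by simpa [RingHom.mem_ker] using h
      revert k i
      simp only [QuadraticAlgebra.ext_iff, pow_two]
      decide
    · fin_cases i <;> fin_cases k <;>
        simp [RingHom.mem_ker, rho, pts, QuadraticAlgebra.ext_iff] <;> decide
  exact this hp

set_option maxHeartbeats 4000000 in
theorem stdForm_inj (z : Fin 14 → ℤ)
    (h : stdForm (tt 0) (tt 1) (tt 2) (tt 3) (tt 4) z = 0) : z = 0 := by
  have hm : stdForm (X 0) (X 1) (X 2) (X 3) (X 4) z ∈ dsIdeal := by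
    rw [← Ideal.Quotient.eq_zero_iff_mem, ← h]
    simp [stdForm, tt]
  have key : ∀ k, stdForm (pts k 0) (pts k 1) (pts k 2) (pts k 3) (pts k 4) z = 0 := by
    intro k
    rw [← aeval_pts k _ hm]
    simp [stdForm]
  have k0 := key 0
  have k1 := key 1
  have k2 := key 2
  have k3 := key 3
  have k4 := key 4
  have k5 := key 5
  have k6 := key 6
  simp [stdForm, pts, QuadraticAlgebra.ext_iff] at k0 k1 k2 k3 k4 k5 k6
  funext j
  fin_cases j <;> simp <;> linarith

/-- The quotient ring `ℤ[t₁,…,t₅]/(tᵢ²+tᵢ+1, ρ_J)` is torsion-free as an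
abelian group. -/
theorem stmt_16 (x : MvPolynomial (Fin 5) ℤ ⧸ dsIdeal) (n : ℤ) (hn : n ≠ 0)
    (hx : n • x = 0) : x = 0 := by
  obtain ⟨p, rfl⟩ := Ideal.Quotient.mk_surjective x
  obtain ⟨z, hz⟩ := exists_stdForm p
  rw [hz] at hx ⊢
  have h0 : stdForm (tt 0) (tt 1) (tt 2) (tt 3) (tt 4) (fun j => n * z j) = 0 := by
    rw [← hx]
    simp only [stdForm, zsmul_eq_mul]
    push_cast
    ring
  have h1 := stdForm_inj _ h0
  have h2 : z = 0 := by
    funext j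
    have := congrFun h1 j
    simpa [hn] using this
  subst h2
  simp [stdForm]

end
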